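/- arXiv:2410.05240 — 2 statements merged into one kernel-verified Lean document; each statement's English description precedes it below -/
import Mathlib

section
/- Every finite loopless multigraph G with maximum degree Δ admits a proper ⌊3Δ/2⌋-edge coloring, i.e., a map assigning to each edge a color in {1,…,⌊3Δ/2⌋} so that any two distinct edges sharing an endpoint—including parallel edges—receive distinct colors. -/
/-- In the group generated by two involutions `s` and `t`, the orbit of a fixed point `x` of `t`
contains at most one fixed point of `s`. -/
theorem exists_invariant_set_of_involutions {V : Type*} [Finite V] {s t : Equiv.Perm V}
    (hs : ∀ v, s (s v) = v) (ht : ∀ v, t (t v) = v) {x y z : V} (hx : t x = x)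
    (hy : s y = y) (hz : s z = z) (hyz : y ≠ z) :
    ∃ S : Set V, x ∈ S ∧ (∀ v ∈ S, s v ∈ S) ∧ (∀ v ∈ S, t v ∈ S) ∧ ¬ (y ∈ S ∧ z ∈ S) := by
  have hs' : s⁻¹ = s := by ext v; rw [Equiv.Perm.inv_eq_iff_eq, hs]
  have ht' : t⁻¹ = t := by ext v; rw [Equiv.Perm.inv_eq_iff_eq, ht]
  have hconj : s * (t * s) * s⁻¹ = (t * s)⁻¹ := by rw [mul_inv_rev, ht', mul_assoc, mul_assoc,
    mul_inv_cancel, mul_one, hs']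
  have hreflect (n : ℤ) : s (((t * s) ^ n) x) = ((t * s) ^ (-n - 1)) x := by
    have h : s * (t * s) ^ n = (t * s) ^ (-n) * s := by
      rw [zpow_neg, ← inv_zpow, ← hconj, conj_zpow, inv_mul_cancel_right]
    have hsx : s x = ((t * s) ^ (-1 : ℤ)) x := by
      rw [zpow_neg_one, mul_inv_rev, ht', hs', Equiv.Perm.mul_apply, hx]
    rw [← Equiv.Perm.mul_apply, h, Equiv.Perm.mul_apply, hsx, ← Equiv.Perm.mul_apply,
      ← zpow_add]
    rfl
  have hsS : ∀ v, (∃ n : ℤ, ((t * s) ^ n) x = v) → ∃ n : ℤ, ((t * s) ^ n) x = s v := by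
    rintro _ ⟨n, rfl⟩
    exact ⟨-n - 1, (hreflect n).symm⟩
  refine ⟨{v | ∃ n : ℤ, ((t * s) ^ n) x = v}, ⟨0, rfl⟩, hsS, ?_, ?_⟩
  · intro v hv
    obtain ⟨n, hn⟩ := hsS v hv
    refine ⟨1 + n, ?_⟩
    rw [zpow_add, Equiv.Perm.mul_apply, hn, zpow_one, Equiv.Perm.mul_apply, hs]
  · rintro ⟨⟨n, rfl⟩, ⟨m, rfl⟩⟩
    apply hyz
    rw [hreflect] at hy hz
    have key (a b : ℤ) : ((t * s) ^ a) x = ((t * s) ^ b) x ↔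
        (MulAction.period (t * s) x : ℤ) ∣ a - b := by
      rw [← MulAction.zpow_smul_eq_iff_period_dvd, sub_eq_neg_add, zpow_add, mul_smul,
        zpow_neg, inv_smul_eq_iff]
      rfl
    rw [key] at hy hz ⊢
    have hodd : IsCoprime (MulAction.period (t * s) x : ℤ) 2 := by
      obtain ⟨k, hk⟩ := hy
      exact ⟨-k, -n, by linear_combination hk⟩
    refine hodd.dvd_of_dvd_mul_left ?_
    have := dvd_sub hz hy
    convert this using 1
    ring

namespace EdgeColoring

variable {V E C : Type*}

/-- `c` restricts to a proper edge coloring of the edges in `F`. -/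
def Proper (ends : E → Sym2 V) (F : Finset E) (c : E → C) : Prop :=
  ∀ e ∈ F, ∀ f ∈ F, e ≠ f → ∀ v, v ∈ ends e → v ∈ ends f → c e ≠ c f

/-- No edge of `F` at the vertex `v` has color `a`. -/
def Missing (ends : E → Sym2 V) (F : Finset E) (c : E → C) (v : V) (a : C) : Prop :=
  ∀ e ∈ F, v ∈ ends e → c e ≠ a

variable {ends : E → Sym2 V} {F : Finset E} {c : E → C}

open Classical in
theorem Proper.insert_update (hc : Proper ends F c) {e : E} {a : C}
    (ha : ∀ v ∈ ends e, Missing ends F c v a) :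
    Proper ends (insert e F) (Function.update c e a) := by
  intro f hf g hg hfg v hvf hvg
  have := hc f
  grind [Missing, Function.update_apply]

open Classical in
theorem Proper.update (hc : Proper ends F c) {e : E} {a : C}
    (ha : ∀ v ∈ ends e, Missing ends F c v a) :
    Proper ends F (Function.update c e a) := by
  intro f hf g hg hfg v hvf hvg
  have := hc f hf g hg hfg v hvf hvg
  grind [Missing, Function.update_apply]

open Classical in
theorem Missing.update {v : V} {a b : C} (hb : Missing ends F c v b) (e : E) (hab : a ≠ b) :
    Missing ends F (Function.update c e a) v b := by
  intro f hf hv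
  have := hb f hf hv
  grind [Function.update_apply]

open Classical in
theorem Proper.missing_update (hc : Proper ends F c) {e : E} (he : e ∈ F) {v : V}
    (hv : v ∈ ends e) {a : C} (ha : a ≠ c e) :
    Missing ends F (Function.update c e a) v (c e) := by
  intro f hf hvf
  have := hc e he f hf
  grind [Function.update_apply]

/-- The involution exchanging the endpoints of every edge of a given color. -/
theorem Proper.exists_involution (hc : Proper ends F c) (a : C) :
    ∃ s : Equiv.Perm V, (∀ v, s (s v) = v) ∧ (∀ v, Missing ends F c v a → s v = v) ∧
      ∀ e ∈ F, c e = a → ∀ u v, ends e = s(u, v) → s u = v := by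
  classical
  let m : V → V := fun v ↦
    if h : ∃ e ∈ F, v ∈ ends e ∧ c e = a then Sym2.Mem.other h.choose_spec.2.1 else v
  have hm : ∀ e ∈ F, c e = a → ∀ u v, ends e = s(u, v) → m u = v := by
    intro e he hea u v huv
    have hu : u ∈ ends e := by simp [huv]
    have h : ∃ e ∈ F, u ∈ ends e ∧ c e = a := ⟨e, he, hu, hea⟩
    have heq : h.choose = e := by
      by_contra hne
      exact hc _ h.choose_spec.1 e he hne u h.choose_spec.2.1 hu
        (h.choose_spec.2.2.trans hea.symm)
    have hspec := (Sym2.other_spec h.choose_spec.2.1).trans ((congrArg ends heq).trans huv)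
    rw [Sym2.congr_right] at hspec
    simp only [m, dif_pos h]
    exact hspec
  have hfix : ∀ v, Missing ends F c v a → m v = v := by
    intro v hv
    refine dif_neg ?_
    rintro ⟨e, he, hve, hea⟩
    exact hv e he hve hea
  have hinv : Function.Involutive m := by
    intro v
    by_cases h : ∃ e ∈ F, v ∈ ends e ∧ c e = a
    · obtain ⟨e, he, ⟨w, hw⟩, hea⟩ := h
      rw [hm e he hea v w hw, hm e he hea w v (hw.trans Sym2.eq_swap)]
    · have : m v = v := dif_neg h
      rw [this, this]
  exact ⟨hinv.toPerm, hinv, hfix, hm⟩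

/-- Kempe change along the component of `x` in the subgraph formed by the colors `b` and `g`:
if `g` is missing at `x`, and `b` is missing at `y ≠ z`, the colors can be exchanged so that `b`
becomes missing at `x` and stays missing at one of `y` and `z`. -/
theorem Proper.exists_swap [Finite V] (hc : Proper ends F c) {b g : C} {x y z : V}
    (hx : Missing ends F c x g) (hy : Missing ends F c y b) (hz : Missing ends F c z b)
    (hyz : y ≠ z) :
    ∃ c' : E → C, Proper ends F c' ∧ (∀ e a, a ≠ b → a ≠ g → (c' e = a ↔ c e = a)) ∧
      Missing ends F c' x b ∧ (Missing ends F c' y b ∨ Missing ends F c' z b) := by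
  classical
  obtain ⟨s, hs, hsfix, hsmap⟩ := hc.exists_involution b
  obtain ⟨t, ht, htfix, htmap⟩ := hc.exists_involution g
  obtain ⟨S, hxS, hsS, htS, hS⟩ := exists_invariant_set_of_involutions hs ht
    (htfix x hx) (hsfix y hy) (hsfix z hz) hyz
  have hclosed : ∀ e ∈ F, c e = b ∨ c e = g → ∀ u v, u ∈ ends e → v ∈ ends e → u ∈ S →
      v ∈ S := by
    intro e he hce u v hu hv huS
    by_cases huv : u = v
    · exact huv ▸ huS
    have hends : ends e = s(u, v) := (Sym2.mem_and_mem_iff huv).1 ⟨hu, hv⟩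
    rcases hce with h | h
    · exact hsmap e he h u v hends ▸ hsS u huS
    · exact htmap e he h u v hends ▸ htS u huS
  let c' : E → C := fun e ↦ if ∃ v ∈ ends e, v ∈ S then Equiv.swap b g (c e) else c e
  have hin : ∀ e ∈ F, ∀ v ∈ ends e, v ∈ S → c' e = Equiv.swap b g (c e) :=
    fun e _ v hv hvS ↦ if_pos ⟨v, hv, hvS⟩
  have hout : ∀ e ∈ F, ∀ v ∈ ends e, v ∉ S → c' e = c e := by
    intro e he v hv hvS
    by_cases h : ∃ v ∈ ends e, v ∈ S
    · obtain ⟨u, hu, huS⟩ := h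
      rw [hin e he u hu huS]
      refine Equiv.swap_apply_of_ne_of_ne ?_ ?_
      · exact fun h ↦ hvS (hclosed e he (.inl h) u v hu hv huS)
      · exact fun h ↦ hvS (hclosed e he (.inr h) u v hu hv huS)
    · exact if_neg h
  have hkeep : ∀ v, v ∉ S → Missing ends F c v b → Missing ends F c' v b := by
    intro v hvS hv e he hve
    rw [hout e he v hve hvS]
    exact hv e he hve
  refine ⟨c', ?_, ?_, ?_, ?_⟩
  · intro e he f hf hef v hve hvf
    by_cases hv : v ∈ S
    · rw [hin e he v hve hv, hin f hf v hvf hv]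
      exact (Equiv.swap b g).injective.ne (hc e he f hf hef v hve hvf)
    · rw [hout e he v hve hv, hout f hf v hvf hv]
      exact hc e he f hf hef v hve hvf
  · intro e a hab hag
    simp only [c']
    split_ifs
    · rw [Equiv.swap_apply_eq_iff, Equiv.swap_apply_of_ne_of_ne hab hag]
    · rfl
  · intro e he hxe h
    rw [hin e he x hxe hxS, Equiv.swap_apply_eq_iff, Equiv.swap_apply_left] at h
    exact hx e he hxe h
  · by_cases hyS : y ∈ S
    · exact .inr (hkeep z (fun hzS ↦ hS ⟨hyS, hzS⟩) hz)
    · exact .inl (hkeep y hyS hy)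

open Classical in
theorem card_le_card_missing_add [Fintype C] (ends : E → Sym2 V) (F : Finset E) (c : E → C)
    (v : V) :
    Fintype.card C ≤ (Finset.univ.filter (Missing ends F c v)).card +
      (F.filter (v ∈ ends ·)).card := by
  have h : (Finset.univ.filter (Missing ends F c v))ᶜ ⊆ (F.filter (v ∈ ends ·)).image c := by
    intro a
    simp [Missing, and_assoc]
  have := (Finset.card_le_card h).trans Finset.card_image_le
  rw [Finset.card_compl] at this
  omega

open Classical in
/-- A proper coloring with enough colors can be extended by one more edge. -/
theorem Proper.exists_insert [Finite V] [Fintype C] {Δ : ℕ} (hC : 3 * Δ ≤ 2 * Fintype.card C + 1)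
    {e : E} (he : e ∉ F)
    (hΔ : ∀ v, ((insert e F).filter (v ∈ ends ·)).card ≤ Δ) (hc : Proper ends F c) :
    ∃ c' : E → C, Proper ends (insert e F) c' := by
  obtain ⟨⟨x, y⟩, hxy⟩ := Quot.exists_rep (ends e)
  replace hxy : ends e = s(x, y) := hxy.symm
  have hdeg (v : V) (hv : v ∈ ends e) : (F.filter (v ∈ ends ·)).card + 1 ≤ Δ := by
    have := hΔ v
    rwa [Finset.filter_insert, if_pos hv, Finset.card_insert_of_notMem (by simp [he])] at this
  have hdeg' (v : V) : (F.filter (v ∈ ends ·)).card ≤ Δ :=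
    (Finset.card_le_card (Finset.filter_subset_filter _ (Finset.subset_insert e F))).trans (hΔ v)
  have extend (d : E → C) (hd : Proper ends F d) (a : C) (hx : Missing ends F d x a)
      (hy : Missing ends F d y a) : ∃ c' : E → C, Proper ends (insert e F) c' := by
    refine ⟨_, hd.insert_update (a := a) ?_⟩
    rintro v hv
    rw [hxy, Sym2.mem_iff] at hv
    rcases hv with rfl | rfl <;> assumption
  have extend_via (d : E → C) (hd : Proper ends F d) (f : E) (hf : f ∈ F) (z : V)
      (hxz : ends f = s(x, z)) (hy : Missing ends F d y (d f)) (a : C)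
      (hxa : Missing ends F d x a) (hza : Missing ends F d z a) :
      ∃ c' : E → C, Proper ends (insert e F) c' := by
    have hxf : x ∈ ends f := by simp [hxz]
    have haf : a ≠ d f := (hxa f hf hxf).symm
    refine extend (Function.update d f a) (hd.update ?_) (d f)
      (hd.missing_update hf hxf haf) (hy.update f haf)
    rintro v hv
    rw [hxz, Sym2.mem_iff] at hv
    rcases hv with rfl | rfl <;> assumption
  by_contra hno
  let M (v : V) : Finset C := Finset.univ.filter (Missing ends F c v)
  have mem_M {v : V} {a : C} : a ∈ M v ↔ Missing ends F c v a := by simp [M]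
  have hM (v : V) : Fintype.card C ≤ (M v).card + (F.filter (v ∈ ends ·)).card :=
    card_le_card_missing_add ends F c v
  have hdx := hdeg x (by simp [hxy])
  have hdy := hdeg y (by simp [hxy])
  have hMx := hM x
  have hMy := hM y
  have hdisj : Disjoint (M x) (M y) := Finset.disjoint_left.2 fun a hx hy ↦
    hno (extend c hc a (mem_M.1 hx) (mem_M.1 hy))
  obtain ⟨g, hg⟩ : (M x).Nonempty := Finset.card_pos.1 (by omega)
  obtain ⟨a, ha⟩ : (M y).Nonempty := Finset.card_pos.1 (by omega)
  have hax : ¬ Missing ends F c x a := fun h ↦ Finset.disjoint_left.1 hdisj (mem_M.2 h) ha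
  simp only [Missing, not_forall, not_not] at hax
  obtain ⟨f, hf, ⟨z, hxz⟩, rfl⟩ := hax
  rw [mem_M] at ha hg
  have hzf : z ∈ ends f := by simp [hxz]
  have hyz : y ≠ z := by
    rintro rfl
    exact ha f hf hzf rfl
  have hdisj' : Disjoint (M x) (M z) := Finset.disjoint_left.2 fun b hx hz ↦
    hno (extend_via c hc f hf z hxz ha b (mem_M.1 hx) (mem_M.1 hz))
  have hyz_inter : ¬ Disjoint (M y) (M z) := by
    intro h
    have hcard := Finset.card_le_univ (M x ∪ (M y ∪ M z))
    rw [Finset.card_union_of_disjoint (Finset.disjoint_union_right.2 ⟨hdisj, hdisj'⟩),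
      Finset.card_union_of_disjoint h] at hcard
    have hMz := hM z
    have hdz := hdeg' z
    omega
  obtain ⟨b, hby, hbz⟩ := Finset.not_disjoint_iff.1 hyz_inter
  rw [mem_M] at hby hbz
  obtain ⟨d, hd, hdc, hxb, hb⟩ := hc.exists_swap hg hby hbz hyz
  rcases hb with hb | hb
  · exact hno (extend d hd b hxb hb)
  · have hfb : c f ≠ b := hbz f hf hzf
    have hfg : c f ≠ g := hg f hf (by simp [hxz])
    have hdf : d f = c f := (hdc f _ hfb hfg).2 rfl
    refine hno (extend_via d hd f hf z hxz ?_ b hxb hb)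
    intro e' he' hy'
    rw [hdf, Ne, hdc e' _ hfb hfg]
    exact ha e' he' hy'

end EdgeColoring

/-- **Shannon's theorem**: every finite loopless multigraph (given by an endpoint map
`ends : E → Sym2 V` with no diagonal values) with maximum degree `Δ` admits a proper
`⌊3Δ/2⌋`-edge coloring: any two distinct edges sharing an endpoint — including parallel
edges — receive distinct colors. -/
theorem shannon_edge_coloring {V E : Type*} [Fintype V] [Fintype E]
    (ends : E → Sym2 V) (hloopless : ∀ e : E, ¬ (ends e).IsDiag)
    (Δ : ℕ) (hΔ : ∀ v : V, Nat.card {e : E // v ∈ ends e} ≤ Δ) :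
    ∃ χ : E → Fin (3 * Δ / 2),
      ∀ e f : E, e ≠ f → (∃ v : V, v ∈ ends e ∧ v ∈ ends f) → χ e ≠ χ f := by
  classical
  have hdeg (F : Finset E) (v : V) : (F.filter (v ∈ ends ·)).card ≤ Δ := by
    refine le_trans ?_ (hΔ v)
    rw [Nat.card_eq_fintype_card, Fintype.card_subtype]
    exact Finset.card_le_card (Finset.filter_subset_filter _ (Finset.subset_univ F))
  rcases isEmpty_or_nonempty E with hE | ⟨⟨e₀⟩⟩
  · exact ⟨isEmptyElim, fun e ↦ isEmptyElim e⟩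
  have hpos : 0 < Δ := by
    obtain ⟨⟨x, y⟩, hxy⟩ := Quot.exists_rep (ends e₀)
    have hx : x ∈ ends e₀ := hxy ▸ Sym2.mem_mk_left x y
    exact (Finset.card_pos.2 ⟨e₀, by simp [hx]⟩).trans_le (hdeg Finset.univ x)
  have main (F : Finset E) : ∃ c : E → Fin (3 * Δ / 2), EdgeColoring.Proper ends F c := by
    induction F using Finset.induction_on with
    | empty => exact ⟨fun _ ↦ ⟨0, by omega⟩, by simp [EdgeColoring.Proper]⟩
    | insert e F he ih =>
      obtain ⟨c, hc⟩ := ih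
      exact hc.exists_insert (Δ := Δ) (by rw [Fintype.card_fin]; omega) he (hdeg _)
  obtain ⟨c, hc⟩ := main Finset.univ
  refine ⟨c, ?_⟩
  rintro e f hef ⟨v, hve, hvf⟩
  exact hc e (Finset.mem_univ e) f (Finset.mem_univ f) hef v hve hvf
end

section
/- Let G be a finite loopless multigraph with maximum degree Δ, let χ be a partial ⌊3Δ/2⌋-edge coloring of G, and let e₀ be an uncolored edge. Then there exists a partial ⌊3Δ/2⌋-edge coloring χ′ of G whose set of colored edges is exactly the set of edges colored by χ together with e₀. -/
/-- A partial `κ`-edge coloring of a multigraph given by an endpoint map `ends : E → Sym2 V`: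
edges may be uncolored (`none`), and any two distinct colored edges sharing an endpoint —
including parallel edges — receive distinct colors. -/
def IsPartialEdgeColoringM {V E : Type*} (ends : E → Sym2 V) {κ : ℕ}
    (χ : E → Option (Fin κ)) : Prop :=
  ∀ e f : E, e ≠ f → (∃ v : V, v ∈ ends e ∧ v ∈ ends f) →
    χ e ≠ none → χ f ≠ none → χ e ≠ χ f

namespace SimpleGraph

open Classical in
/-- In a graph of maximum degree at most two, a connected component contains at most two vertices
of degree at most one. -/
theorem not_reachable_of_three_degree_le_one {V : Type*} [Fintype V] (G : SimpleGraph V)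
    (h2 : ∀ v, G.degree v ≤ 2) {x y z : V} (hxy : x ≠ y) (hxz : x ≠ z) (hyz : y ≠ z)
    (hx : G.degree x ≤ 1) (hy : G.degree y ≤ 1) (hz : G.degree z ≤ 1)
    (hrxy : G.Reachable x y) : ¬ G.Reachable x z := by
  intro hrxz
  let S : Set V := (G.connectedComponentMk x).supp
  have hmem : ∀ v, G.Reachable x v → v ∈ S := fun v hv =>
    ConnectedComponent.sound hv.symm
  have hconn : (G.induce S).Connected :=
    (G.connectedComponentMk x).connected_toSimpleGraph
  have hcard := hconn.card_vert_le_card_edgeSet_add_one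
  rw [Nat.card_eq_fintype_card, Nat.card_eq_fintype_card, ← edgeFinset_card] at hcard
  have hsum := (G.induce S).sum_degrees_eq_twice_card_edges
  have hdeg : ∀ v : S, (G.induce S).degree v ≤ G.degree v := fun v => by
    rw [← card_neighborFinset_eq_degree, ← card_neighborFinset_eq_degree]
    refine Finset.card_le_card_of_injOn Subtype.val (fun w hw => ?_) Subtype.val_injective.injOn
    simpa using hw
  let T : Finset S :=
    {⟨x, hmem x (Reachable.refl x)⟩, ⟨y, hmem y hrxy⟩, ⟨z, hmem z hrxz⟩}
  have hT : T.card = 3 := Finset.card_eq_three.mpr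
    ⟨_, _, _, by simpa using hxy, by simpa using hxz, by simpa using hyz, rfl⟩
  have hle : ∑ v : S, ((G.induce S).degree v + if v ∈ T then 1 else 0) ≤ ∑ _v : S, 2 := by
    refine Finset.sum_le_sum fun v _ => ?_
    have := hdeg v
    have := h2 v
    split_ifs with hv
    · simp only [T, Finset.mem_insert, Finset.mem_singleton] at hv
      rcases hv with rfl | rfl | rfl <;> simp only at * <;> omega
    · omega
  rw [Finset.sum_add_distrib, hsum] at hle
  simp only [Finset.sum_ite_mem, Finset.univ_inter, Finset.sum_const, Finset.card_univ,
    smul_eq_mul, hT] at hle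
  omega

end SimpleGraph

section PartialEdgeColoring

variable {V E : Type*} {ends : E → Sym2 V} {κ : ℕ} {χ : E → Option (Fin κ)}

/-- The color `c` is missing at the vertex `v`: no edge at `v` has color `c`. -/
def IsMissingColor (ends : E → Sym2 V) (χ : E → Option (Fin κ)) (v : V) (c : Fin κ) : Prop :=
  ∀ e, v ∈ ends e → χ e ≠ some c

theorem IsPartialEdgeColoringM.eq_of_mem (hχ : IsPartialEdgeColoringM ends χ) {e f : E} {v : V}
    {c : Fin κ} (he : v ∈ ends e) (hf : v ∈ ends f) (hec : χ e = some c) (hfc : χ f = some c) :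
    e = f := by
  by_contra hne
  exact hχ e f hne ⟨v, he, hf⟩ (by simp [hec]) (by simp [hfc]) (hec.trans hfc.symm)

theorem isPartialEdgeColoringM_of_eq_of_mem
    (h : ∀ e f : E, ∀ v : V, ∀ c : Fin κ, v ∈ ends e → v ∈ ends f → χ e = some c →
      χ f = some c → e = f) : IsPartialEdgeColoringM ends χ := by
  rintro e f hne ⟨v, he, hf⟩ hec _ heq
  obtain ⟨c, hc⟩ := Option.ne_none_iff_exists'.mp hec
  exact hne (h e f v c he hf hc (heq ▸ hc))

open Classical in
/-- An edge may be given a color that is missing at both of its ends. -/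
theorem IsPartialEdgeColoringM.update (hχ : IsPartialEdgeColoringM ends χ) {e₀ : E} {c : Fin κ}
    (hc : ∀ v ∈ ends e₀, IsMissingColor ends χ v c) :
    IsPartialEdgeColoringM ends (Function.update χ e₀ (some c)) := by
  refine isPartialEdgeColoringM_of_eq_of_mem fun e f v d he hf hed hfd => ?_
  by_cases h1 : e = e₀ <;> by_cases h2 : f = e₀
  · exact h1.trans h2.symm
  · subst h1
    simp only [Function.update_self, Function.update_of_ne h2, Option.some.injEq] at hed hfd
    exact absurd (hed ▸ hfd) (hc v he f hf)
  · subst h2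
    simp only [Function.update_self, Function.update_of_ne h1, Option.some.injEq] at hed hfd
    exact absurd (hfd ▸ hed) (hc v hf e he)
  · rw [Function.update_of_ne h1] at hed
    rw [Function.update_of_ne h2] at hfd
    exact hχ.eq_of_mem he hf hed hfd

/-- The simple graph underlying the edges of colors `a` and `b`. -/
def kempeGraph (hloopless : ∀ e : E, ¬ (ends e).IsDiag) (χ : E → Option (Fin κ))
    (a b : Fin κ) : SimpleGraph V where
  Adj u v := ∃ e, ends e = s(u, v) ∧ (χ e = some a ∨ χ e = some b)
  symm := ⟨fun _ _ ⟨e, he, h⟩ => ⟨e, he.trans Sym2.eq_swap, h⟩⟩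
  loopless := ⟨fun _ ⟨e, he, _⟩ => hloopless e (he ▸ rfl)⟩

open Classical in
theorem kempeGraph_degree_le (hloopless : ∀ e : E, ¬ (ends e).IsDiag)
    (hχ : IsPartialEdgeColoringM ends χ) (a b : Fin κ) (v : V)
    [Fintype ((kempeGraph hloopless χ a b).neighborSet v)] :
    (kempeGraph hloopless χ a b).degree v ≤
      (({a, b} : Finset (Fin κ)).filter fun c => ¬ IsMissingColor ends χ v c).card := by
  have key : ∀ w, (kempeGraph hloopless χ a b).Adj v w →
      ∃ c, (c = a ∨ c = b) ∧ ∃ e, ends e = s(v, w) ∧ χ e = some c := by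
    rintro w ⟨e, he, h | h⟩
    exacts [⟨a, .inl rfl, e, he, h⟩, ⟨b, .inr rfl, e, he, h⟩]
  have : Nonempty (Fin κ) := ⟨a⟩
  choose! f hf hedge using key
  rw [← SimpleGraph.card_neighborFinset_eq_degree]
  refine Finset.card_le_card_of_injOn f (fun w hw => ?_) fun w hw w' hw' heq => ?_
  · replace hw : (kempeGraph hloopless χ a b).Adj v w := by simpa using hw
    simp only [Finset.coe_filter, Finset.mem_insert, Finset.mem_singleton, Set.mem_ofPred_eq]
    obtain ⟨e, he, hec⟩ := hedge w hw
    exact ⟨hf w hw, fun h => h e (by simp [he]) hec⟩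
  · replace hw : (kempeGraph hloopless χ a b).Adj v w := by simpa using hw
    replace hw' : (kempeGraph hloopless χ a b).Adj v w' := by simpa using hw'
    obtain ⟨e, he, hec⟩ := hedge w hw
    obtain ⟨e', he', hec'⟩ := hedge w' hw'
    obtain rfl : e = e' := hχ.eq_of_mem (v := v) (by simp [he]) (by simp [he']) hec (heq ▸ hec')
    exact Sym2.congr_right.mp (he.symm.trans he')

theorem kempeGraph_degree_le_two (hloopless : ∀ e : E, ¬ (ends e).IsDiag)
    (hχ : IsPartialEdgeColoringM ends χ) (a b : Fin κ) (v : V)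
    [Fintype ((kempeGraph hloopless χ a b).neighborSet v)] :
    (kempeGraph hloopless χ a b).degree v ≤ 2 := by
  classical
  exact (kempeGraph_degree_le hloopless hχ a b v).trans
    ((Finset.card_filter_le _ _).trans Finset.card_le_two)

theorem kempeGraph_degree_le_one (hloopless : ∀ e : E, ¬ (ends e).IsDiag)
    (hχ : IsPartialEdgeColoringM ends χ) {a b : Fin κ} {v : V}
    [Fintype ((kempeGraph hloopless χ a b).neighborSet v)]
    (h : IsMissingColor ends χ v a ∨ IsMissingColor ends χ v b) :
    (kempeGraph hloopless χ a b).degree v ≤ 1 := by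
  classical
  have hle : (({a, b} : Finset (Fin κ)).filter fun c => ¬ IsMissingColor ends χ v c).card ≤ 1 := by
    refine Finset.card_le_one.mpr fun c hc d hd => ?_
    simp only [Finset.mem_filter, Finset.mem_insert, Finset.mem_singleton] at hc hd
    obtain ⟨hc | hc, hc'⟩ := hc <;> obtain ⟨hd | hd, hd'⟩ := hd <;> subst hc <;> subst hd <;> tauto
  exact (kempeGraph_degree_le hloopless hχ a b v).trans hle

open Classical in
/-- Exchange the colors `a` and `b` on the edges meeting `S`. -/
noncomputable def kempeSwap (ends : E → Sym2 V) (χ : E → Option (Fin κ)) (a b : Fin κ)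
    (S : Set V) (e : E) : Option (Fin κ) :=
  if ∃ v ∈ ends e, v ∈ S then (χ e).map (Equiv.swap a b) else χ e

theorem kempeSwap_eq_none_iff {a b : Fin κ} {S : Set V} {e : E} :
    kempeSwap ends χ a b S e = none ↔ χ e = none := by
  unfold kempeSwap
  split_ifs <;> simp

theorem kempeSwap_of_mem {a b : Fin κ} {S : Set V} {e : E} {v : V} (hv : v ∈ ends e)
    (hS : v ∈ S) : kempeSwap ends χ a b S e = (χ e).map (Equiv.swap a b) :=
  if_pos ⟨v, hv, hS⟩

theorem kempeSwap_of_notMem (hloopless : ∀ e : E, ¬ (ends e).IsDiag) {a b : Fin κ} {u : V}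
    {e : E} {v : V} (hv : v ∈ ends e) (hS : ¬ (kempeGraph hloopless χ a b).Reachable u v) :
    kempeSwap ends χ a b {w | (kempeGraph hloopless χ a b).Reachable u w} e = χ e := by
  unfold kempeSwap
  split_ifs with h
  · obtain ⟨w, hw, hwS⟩ := h
    have hne : w ≠ v := by rintro rfl; exact hS hwS
    have hends : ends e = s(w, v) := ((Sym2.mem_and_mem_iff hne).mp ⟨hw, hv⟩)
    have hcol : ¬ (χ e = some a ∨ χ e = some b) := fun hc =>
      hS (SimpleGraph.Reachable.trans hwS (SimpleGraph.Adj.reachable ⟨e, hends, hc⟩))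
    cases hχe : χ e with
    | none => rfl
    | some c =>
      simp only [hχe, Option.some.injEq, not_or] at hcol
      simp [Equiv.swap_apply_of_ne_of_ne hcol.1 hcol.2]
  · rfl

theorem kempeSwap_eq_some_of_ne {a b c : Fin κ} {S : Set V} {e : E} (hca : c ≠ a) (hcb : c ≠ b) :
    kempeSwap ends χ a b S e = some c ↔ χ e = some c := by
  unfold kempeSwap
  split_ifs
  · rw [Option.map_eq_some_iff]
    constructor
    · rintro ⟨d, hd, hdc⟩
      rw [Equiv.swap_apply_eq_iff, Equiv.swap_apply_of_ne_of_ne hca hcb] at hdc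
      rwa [← hdc]
    · exact fun h => ⟨c, h, Equiv.swap_apply_of_ne_of_ne hca hcb⟩
  · rfl

theorem IsPartialEdgeColoringM.kempeSwap (hloopless : ∀ e : E, ¬ (ends e).IsDiag)
    (hχ : IsPartialEdgeColoringM ends χ) (a b : Fin κ) (u : V) :
    IsPartialEdgeColoringM ends
      (kempeSwap ends χ a b {w | (kempeGraph hloopless χ a b).Reachable u w}) := by
  refine isPartialEdgeColoringM_of_eq_of_mem fun e f v c he hf hec hfc => ?_
  by_cases hv : (kempeGraph hloopless χ a b).Reachable u v
  · rw [kempeSwap_of_mem he hv, Option.map_eq_some_iff] at hec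
    rw [kempeSwap_of_mem hf hv, Option.map_eq_some_iff] at hfc
    obtain ⟨d, hd, hdc⟩ := hec
    obtain ⟨d', hd', hdc'⟩ := hfc
    obtain rfl : d = d' := (Equiv.swap a b).injective (hdc.trans hdc'.symm)
    exact hχ.eq_of_mem he hf hd hd'
  · rw [kempeSwap_of_notMem hloopless he hv] at hec
    rw [kempeSwap_of_notMem hloopless hf hv] at hfc
    exact hχ.eq_of_mem he hf hec hfc

theorem IsMissingColor.kempeSwap_of_mem {a b : Fin κ} {S : Set V} {v : V} (hv : v ∈ S)
    (h : IsMissingColor ends χ v b) : IsMissingColor ends (kempeSwap ends χ a b S) v a := by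
  intro e he hea
  rw [_root_.kempeSwap_of_mem he hv, Option.map_eq_some_iff] at hea
  obtain ⟨d, hd, hda⟩ := hea
  rw [Equiv.swap_apply_eq_iff, Equiv.swap_apply_left] at hda
  exact h e he (hda ▸ hd)

theorem IsMissingColor.kempeSwap_of_notMem (hloopless : ∀ e : E, ¬ (ends e).IsDiag)
    {a b c : Fin κ} {u v : V} (hv : ¬ (kempeGraph hloopless χ a b).Reachable u v)
    (h : IsMissingColor ends χ v c) : IsMissingColor ends
      (kempeSwap ends χ a b {w | (kempeGraph hloopless χ a b).Reachable u w}) v c := by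
  intro e he
  rw [_root_.kempeSwap_of_notMem hloopless he hv]
  exact h e he

open Classical in
/-- The colors missing at a vertex are at least as many as the colors exceeding the number of
edges in any set containing all colored edges at that vertex. -/
theorem le_card_filter_isMissingColor_add (χ : E → Option (Fin κ)) {v : V} {s : Finset E}
    (hs : ∀ e, v ∈ ends e → χ e ≠ none → e ∈ s) :
    κ ≤ (Finset.univ.filter fun c => IsMissingColor ends χ v c).card + s.card := by
  have hle : (Finset.univ.filter fun c => ¬ IsMissingColor ends χ v c).card ≤ s.card := by
    have hsub : (Finset.univ.filter fun c => ¬ IsMissingColor ends χ v c).image some ⊆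
        s.image χ := by
      intro o ho
      simp only [Finset.mem_image, Finset.mem_filter, Finset.mem_univ, true_and,
        IsMissingColor, not_forall, not_not] at ho ⊢
      obtain ⟨c, ⟨e, he, hec⟩, rfl⟩ := ho
      exact ⟨e, hs e he (by simp [hec]), hec⟩
    rw [← Finset.card_image_of_injective _ (Option.some_injective _)]
    exact (Finset.card_le_card hsub).trans Finset.card_image_le
  have := Finset.card_filter_add_card_filter_not (s := (Finset.univ : Finset (Fin κ)))
    (fun c => IsMissingColor ends χ v c)
  rw [Finset.card_univ, Fintype.card_fin] at this
  omega

/-- `e₀` can be added to the colored edges of `χ` after recoloring. -/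
def IsExtendableAt (ends : E → Sym2 V) (χ : E → Option (Fin κ)) (e₀ : E) : Prop :=
  ∃ χ' : E → Option (Fin κ), IsPartialEdgeColoringM ends χ' ∧
    {e : E | χ' e ≠ none} = insert e₀ {e : E | χ e ≠ none}

theorem IsExtendableAt.of_eq_none_iff {χ' : E → Option (Fin κ)} {e₀ : E}
    (h : IsExtendableAt ends χ' e₀) (hχ' : ∀ e, χ' e = none ↔ χ e = none) :
    IsExtendableAt ends χ e₀ := by
  obtain ⟨ψ, hψ, hset⟩ := h
  exact ⟨ψ, hψ, by simpa only [ne_eq, hχ'] using hset⟩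

/-- A color missing at both ends of `e₀` can be given to `e₀`. -/
theorem IsPartialEdgeColoringM.isExtendableAt_of_common (hχ : IsPartialEdgeColoringM ends χ)
    {e₀ : E} {x y : V} (he₀ : ends e₀ = s(x, y)) {c : Fin κ} (hx : IsMissingColor ends χ x c)
    (hy : IsMissingColor ends χ y c) : IsExtendableAt ends χ e₀ := by
  classical
  refine ⟨Function.update χ e₀ (some c), hχ.update fun v hv => ?_, ?_⟩
  · rw [he₀, Sym2.mem_iff] at hv
    rcases hv with rfl | rfl <;> assumption
  · ext e
    by_cases h : e = e₀ <;> simp [h]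

/-- Shift colors along a fan with two edges `e₀ = xy` and `e₁ = xz`. -/
theorem IsPartialEdgeColoringM.isExtendableAt_of_fan (hχ : IsPartialEdgeColoringM ends χ)
    {e₀ e₁ : E} {x y z : V} (he₀ : ends e₀ = s(x, y)) (he₁ : ends e₁ = s(x, z))
    {a b : Fin κ} (hab : a ≠ b) (hy : IsMissingColor ends χ y b) (hb : χ e₁ = some b)
    (hx : IsMissingColor ends χ x a) (hz : IsMissingColor ends χ z a) :
    IsExtendableAt ends χ e₀ := by
  classical
  have hψ : IsPartialEdgeColoringM ends (Function.update χ e₁ (some a)) := hχ.update fun v hv => by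
    rw [he₁, Sym2.mem_iff] at hv
    rcases hv with rfl | rfl <;> assumption
  refine (hψ.isExtendableAt_of_common he₀ (c := b) (fun e he => ?_) fun e he => ?_).of_eq_none_iff
    fun e => ?_
  · by_cases h : e = e₁
    · simpa [h] using hab
    · rw [Function.update_of_ne h]
      exact fun heb => h (hχ.eq_of_mem he (by simp [he₁]) heb hb)
  · by_cases h : e = e₁
    · simpa [h] using hab
    · rw [Function.update_of_ne h]
      exact hy e he
  · by_cases h : e = e₁ <;> simp [h, hb]

/-- A Kempe change at `x` separating `x` from `y` makes `e₀ = xy` colorable. -/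
theorem IsPartialEdgeColoringM.isExtendableAt_of_not_reachable
    (hloopless : ∀ e : E, ¬ (ends e).IsDiag) (hχ : IsPartialEdgeColoringM ends χ)
    {e₀ : E} {x y : V} (he₀ : ends e₀ = s(x, y)) {a b : Fin κ}
    (hx : IsMissingColor ends χ x b) (hy : IsMissingColor ends χ y a)
    (hr : ¬ (kempeGraph hloopless χ a b).Reachable x y) : IsExtendableAt ends χ e₀ :=
  ((hχ.kempeSwap hloopless a b x).isExtendableAt_of_common he₀
    (hx.kempeSwap_of_mem (SimpleGraph.Reachable.refl x))
    (hy.kempeSwap_of_notMem hloopless hr)).of_eq_none_iff fun _ => kempeSwap_eq_none_iff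

/-- A color missing at both outer ends of a fan with two edges makes `e₀` colorable. -/
theorem IsPartialEdgeColoringM.isExtendableAt_of_fan_common [Fintype V]
    (hloopless : ∀ e : E, ¬ (ends e).IsDiag) (hχ : IsPartialEdgeColoringM ends χ)
    {e₀ e₁ : E} {x y z : V} (he₀ : ends e₀ = s(x, y)) (he₁ : ends e₁ = s(x, z))
    {a b c : Fin κ} (hx : IsMissingColor ends χ x a) (hyb : IsMissingColor ends χ y b)
    (hb : χ e₁ = some b) (hyc : IsMissingColor ends χ y c) (hzc : IsMissingColor ends χ z c) :
    IsExtendableAt ends χ e₀ := by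
  have hab : a ≠ b := by
    rintro rfl
    exact hx e₁ (by simp [he₁]) hb
  have hbc : b ≠ c := by
    rintro rfl
    exact hzc e₁ (by simp [he₁]) hb
  have hxy : x ≠ y := by
    rintro rfl
    exact hloopless e₀ (he₀ ▸ rfl)
  have hxz : x ≠ z := by
    rintro rfl
    exact hloopless e₁ (he₁ ▸ rfl)
  have hyz : y ≠ z := by
    rintro rfl
    exact hyb e₁ (by simp [he₁]) hb
  by_cases hr : (kempeGraph hloopless χ a c).Reachable y x
  swap
  · exact hχ.isExtendableAt_of_not_reachable hloopless (he₀.trans Sym2.eq_swap) hyc hx hr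
  have hyz' : ¬ (kempeGraph hloopless χ a c).Reachable y z := by
    classical
    exact SimpleGraph.not_reachable_of_three_degree_le_one _
      (fun v => kempeGraph_degree_le_two hloopless hχ a c v) hxy.symm hyz hxz
      (kempeGraph_degree_le_one hloopless hχ (.inr hyc))
      (kempeGraph_degree_le_one hloopless hχ (.inl hx))
      (kempeGraph_degree_le_one hloopless hχ (.inr hzc)) hr
  have hzy : ¬ (kempeGraph hloopless χ a c).Reachable z y := fun h => hyz' h.symm
  have hzx : ¬ (kempeGraph hloopless χ a c).Reachable z x := fun h => hyz' (hr.trans h.symm)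
  exact ((hχ.kempeSwap hloopless a c z).isExtendableAt_of_fan he₀ he₁ hab
    (hyb.kempeSwap_of_notMem hloopless hzy) ((kempeSwap_eq_some_of_ne hab.symm hbc).mpr hb)
    (hx.kempeSwap_of_notMem hloopless hzx)
    (hzc.kempeSwap_of_mem (SimpleGraph.Reachable.refl z))).of_eq_none_iff
    fun _ => kempeSwap_eq_none_iff

end PartialEdgeColoring

/-- **One-edge color extension for Shannon's theorem**: any partial `⌊3Δ/2⌋`-edge coloring of
a finite loopless multigraph with maximum degree `Δ` can be extended to any given uncolored
edge `e₀`, possibly recoloring other edges, without uncoloring any edge. -/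
theorem shannon_extend_one_edge {V E : Type*} [Fintype V] [Fintype E]
    (ends : E → Sym2 V) (hloopless : ∀ e : E, ¬ (ends e).IsDiag)
    (Δ : ℕ) (hΔ : ∀ v : V, Nat.card {e : E // v ∈ ends e} ≤ Δ)
    (χ : E → Option (Fin (3 * Δ / 2))) (hχ : IsPartialEdgeColoringM ends χ)
    (e₀ : E) (hunc : χ e₀ = none) :
    ∃ χ' : E → Option (Fin (3 * Δ / 2)), IsPartialEdgeColoringM ends χ' ∧
      {e : E | χ' e ≠ none} = insert e₀ {e : E | χ e ≠ none} := by
  classical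
  change IsExtendableAt ends χ e₀
  by_contra hext
  obtain ⟨x, y, he₀⟩ : ∃ x y, ends e₀ = s(x, y) :=
    (ends e₀).ind (fun x y => ⟨x, y, rfl⟩)
  let M : V → Finset (Fin (3 * Δ / 2)) := fun v =>
    Finset.univ.filter fun c => IsMissingColor ends χ v c
  have hM : ∀ v c, c ∈ M v ↔ IsMissingColor ends χ v c := fun v c => by simp [M]
  have hdeg : ∀ v, (Finset.univ.filter fun e => v ∈ ends e).card ≤ Δ := fun v => by
    rw [← Fintype.card_subtype, ← Nat.card_eq_fintype_card]
    exact hΔ v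
  have hfree : ∀ v, 3 * Δ / 2 ≤ (M v).card + Δ := fun v =>
    (le_card_filter_isMissingColor_add χ (s := Finset.univ.filter fun e => v ∈ ends e)
      (by simp +contextual)).trans (Nat.add_le_add_left (hdeg v) _)
  have hfree₀ : ∀ v ∈ ends e₀, 3 * Δ / 2 + 1 ≤ (M v).card + Δ := fun v hv => by
    have hle := le_card_filter_isMissingColor_add (ends := ends) χ (v := v)
      (s := (Finset.univ.filter fun e => v ∈ ends e).erase e₀) (fun e he hne => by
        simp only [Finset.mem_erase, Finset.mem_filter, Finset.mem_univ, true_and]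
        exact ⟨fun h => hne (h ▸ hunc), he⟩)
    have hcard := Finset.card_erase_add_one
      (show e₀ ∈ Finset.univ.filter fun e => v ∈ ends e by simpa using hv)
    have := hdeg v
    change _ ≤ (M v).card + _ at hle
    omega
  have hx := hfree₀ x (by simp [he₀])
  have hy := hfree₀ y (by simp [he₀])
  obtain ⟨a, ha⟩ : (M x).Nonempty := Finset.card_pos.mp (by omega)
  obtain ⟨b, hb⟩ : (M y).Nonempty := Finset.card_pos.mp (by omega)
  rw [hM] at ha hb
  have hxy : Disjoint (M x) (M y) := Finset.disjoint_left.mpr fun c hcx hcy =>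
    hext (hχ.isExtendableAt_of_common he₀ ((hM _ _).mp hcx) ((hM _ _).mp hcy))
  obtain ⟨e₁, hxe₁, hb₁⟩ : ∃ e, x ∈ ends e ∧ χ e = some b := by
    by_contra! h
    exact hext (hχ.isExtendableAt_of_common he₀ h hb)
  obtain ⟨z, he₁⟩ := Sym2.mem_iff_exists.mp hxe₁
  have hxz : Disjoint (M x) (M z) := Finset.disjoint_left.mpr fun c hcx hcz => by
    rw [hM] at hcx hcz
    exact hext (hχ.isExtendableAt_of_fan he₀ he₁
      (by rintro rfl; exact hcx e₁ hxe₁ hb₁) hb hb₁ hcx hcz)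
  have hyz : Disjoint (M y) (M z) := Finset.disjoint_left.mpr fun c hcy hcz =>
    hext (hχ.isExtendableAt_of_fan_common hloopless he₀ he₁ ha hb hb₁
      ((hM _ _).mp hcy) ((hM _ _).mp hcz))
  have hz := hfree z
  have hle := Finset.card_le_univ (M x ∪ M y ∪ M z)
  rw [Finset.card_union_of_disjoint (Finset.disjoint_union_left.mpr ⟨hxz, hyz⟩),
    Finset.card_union_of_disjoint hxy, Fintype.card_fin] at hle
  omega
end
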